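/- arXiv:0803.4020 — 2 statements merged into one kernel-verified Lean document; each statement's English description precedes it below -/
import Mathlib

section
/- Let λ ∈ (0,1), F, G ∈ 𝒴, γ, b, a ∈ ℝ, Ã, B̃ ∈ 𝒴, and set A = Ã + γ and B = B̃ + b·φ. If (a, A, B) solves the system (LA)' = a·((λ−3)·Q'' − Q²)' + F and (LB)' = (3−λ)·A'' + 2Q·A + a·(2λ−3)·Q'' + G, then necessarily a = −(20/(15 + 10λ − λ²))·(1/∫Q²)·( −γ·∫P_λ + ∫G·Q + ∫F(x)·(∫₀ˣ P_λ(y) dy) dx ). -/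
open Real MeasureTheory Filter

noncomputable section

/-- `Qs x = (3/2) * sech²(x/2)`. -/
def Qs (x : ℝ) : ℝ := (3/2) * (1 / Real.cosh (x/2))^2

/-- The solitary wave profile `φ_c`. -/
def phic (c : ℝ) (x : ℝ) : ℝ := (c - 1) * Qs (Real.sqrt ((c - 1)/c) * x)

/-- The linearized operator `L f = -f'' + f - 2 Q f`. -/
def Lop (f : ℝ → ℝ) (x : ℝ) : ℝ := -(iteratedDeriv 2 f x) + f x - 2 * Qs x * f x

/-- `φ = -Q'/Q`. -/
def phi0 (x : ℝ) : ℝ := -(deriv Qs x / Qs x)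

/-- `P_λ = 2Q + ((3-λ)/2) x Q'`. -/
def Pl (lam : ℝ) (x : ℝ) : ℝ := 2 * Qs x + ((3 - lam)/2) * x * deriv Qs x

/-- The space `𝒴` of smooth functions with exponential decay of all derivatives. -/
def inY (f : ℝ → ℝ) : Prop :=
  ContDiff ℝ (⊤ : ℕ∞) f ∧ ∀ j : ℕ, ∃ K r : ℝ, 0 < K ∧ 0 < r ∧
    ∀ x : ℝ, |iteratedDeriv j f x| ≤ K * (1 + |x|) ^ r * Real.exp (-|x|)

/-- The `H¹(ℝ)` norm. -/
def H1norm (v : ℝ → ℝ) : ℝ := Real.sqrt (∫ x : ℝ, ((v x)^2 + (deriv v x)^2))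

/-- The `H¹` norm restricted to a set. -/
def H1normOn (s : Set ℝ) (v : ℝ → ℝ) : ℝ :=
  Real.sqrt (∫ x in s, ((v x)^2 + (deriv v x)^2))

/-- The weighted norm `H¹_c`. -/
def H1cnorm (c : ℝ) (v : ℝ → ℝ) : ℝ :=
  Real.sqrt (∫ x : ℝ, ((deriv v x)^2 + (c - 1) * (v x)^2))

/-- The `L²(ℝ)` norm. -/
def L2norm (v : ℝ → ℝ) : ℝ := Real.sqrt (∫ x : ℝ, (v x)^2)

/-- The BBM residual `(1-∂ₓ²)∂ₜu + ∂ₓ(u+u²)` at `(t,x)`. -/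
def bbmRes (u : ℝ → ℝ → ℝ) (t x : ℝ) : ℝ :=
  deriv (fun s => u s x) t
    - iteratedDeriv 2 (fun y => deriv (fun s => u s y) t) x
    + deriv (fun y => u t y + (u t y)^2) x

/-- An `H¹` solution of the BBM equation. -/
def IsBBMSol (u : ℝ → ℝ → ℝ) : Prop :=
  (Continuous fun p : ℝ × ℝ => u p.1 p.2) ∧
  (∀ t : ℝ, Integrable (fun x => (u t x)^2) ∧ Integrable (fun x => (deriv (u t) x)^2)) ∧
  (∀ t x : ℝ, bbmRes u t x = 0)

/-- The energy `E(u) = ∫ (u²/2 + u³/3)`. -/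
def Efun (u : ℝ → ℝ) : ℝ := ∫ x : ℝ, ((u x)^2/2 + (u x)^3/3)

/-- `N(u) = (1/2) ∫ (uₓ² + u²)`. -/
def Nfun (u : ℝ → ℝ) : ℝ := (1/2) * ∫ x : ℝ, ((deriv u x)^2 + (u x)^2)

/-- The collision time scale `T`. -/
def Tcol (c1 c2 : ℝ) : ℝ :=
  ((c2 - 1)/c2) ^ (-(1/2 : ℝ) - 1/100)
    * ((1 - (c1 - 1)/c1)/((c1 - 1)/c1)) * ((c1 - 1)/c1) ^ ((1 : ℝ)/100)

/-- The index set `Σ₀ = {(k,l) : k ≥ 1, k+l ≤ 3}`. -/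
def Sigma0 : Finset (ℕ × ℕ) :=
  (Finset.range 4 ×ˢ Finset.range 4).filter (fun p => 1 ≤ p.1 ∧ p.1 + p.2 ≤ 3)

end

open scoped Topology

/-- Decay at rate `exp (-|x| / 2)`. -/
def ExpDecay (f : ℝ → ℝ) : Prop := ∃ C : ℝ, ∀ x : ℝ, |f x| ≤ C * exp (-|x| / 2)

theorem integrable_exp_neg_abs_div_two : Integrable (fun x : ℝ => exp (-|x| / 2)) := by
  rw [← integrableOn_univ, ← Set.Iic_union_Ioi (a := (0 : ℝ))]
  refine IntegrableOn.union ?_ ?_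
  · refine (integrableOn_exp_mul_Iic (a := 1 / 2) (by norm_num) 0).congr_fun ?_ measurableSet_Iic
    intro x hx
    have hx : x ≤ 0 := hx
    simp only [abs_of_nonpos hx]
    congr 1; ring
  · refine (integrableOn_exp_mul_Ioi (a := -1 / 2) (by norm_num) 0).congr_fun ?_ measurableSet_Ioi
    intro x hx
    have hx : 0 < x := hx
    simp only [abs_of_pos hx]
    congr 1; ring

theorem tendsto_exp_neg_abs_div_two :
    Tendsto (fun x : ℝ => exp (-|x| / 2)) (cocompact ℝ) (𝓝 0) := by
  refine tendsto_exp_atBot.comp ?_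
  have h : Tendsto (fun x : ℝ => |x| / 2) (cocompact ℝ) atTop :=
    (tendsto_norm_cocompact_atTop (E := ℝ)).atTop_div_const (by norm_num)
  simpa [neg_div] using h

namespace ExpDecay

variable {f g : ℝ → ℝ}

theorem tendsto (hf : ExpDecay f) : Tendsto f (cocompact ℝ) (𝓝 0) := by
  obtain ⟨C, hC⟩ := hf
  refine squeeze_zero_norm (fun x => hC x) ?_
  simpa using tendsto_exp_neg_abs_div_two.const_mul C

theorem integrable (hf : ExpDecay f) (hc : Continuous f) : Integrable f := by
  obtain ⟨C, hC⟩ := hf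
  exact (integrable_exp_neg_abs_div_two.const_mul C).mono' hc.aestronglyMeasurable
    (ae_of_all _ hC)

theorem mul_bounded (hf : ExpDecay f) {M : ℝ} (hg : ∀ x, |g x| ≤ M) :
    ExpDecay (fun x => f x * g x) := by
  obtain ⟨C, hC⟩ := hf
  refine ⟨C * M, fun x => ?_⟩
  rw [abs_mul]
  calc |f x| * |g x| ≤ (C * exp (-|x| / 2)) * M :=
        mul_le_mul (hC x) (hg x) (abs_nonneg _) ((abs_nonneg _).trans (hC x))
    _ = C * M * exp (-|x| / 2) := by ring

end ExpDecay

theorem one_add_rpow_mul_exp_neg_le {r : ℝ} :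
    ∃ C : ℝ, ∀ u : ℝ, 0 ≤ u → (1 + u) ^ r * exp (-u) ≤ C * exp (-u / 2) := by
  obtain ⟨n, hn⟩ := exists_nat_ge r
  refine ⟨2 ^ n * n.factorial * exp (1 / 2), fun u hu => ?_⟩
  have h1 : (1 + u) ^ r ≤ (1 + u) ^ n := by
    rw [← rpow_natCast]
    exact rpow_le_rpow_of_exponent_le (by linarith) hn
  have h2 := Real.pow_div_factorial_le_exp (x := (1 + u) / 2) (by linarith) n
  rw [div_le_iff₀ (by positivity), div_pow, div_le_iff₀ (by positivity)] at h2
  calc (1 + u) ^ r * exp (-u)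
      ≤ (exp ((1 + u) / 2) * n.factorial * 2 ^ n) * exp (-u) := by gcongr; exact h1.trans h2
    _ = 2 ^ n * n.factorial * (exp ((1 + u) / 2) * exp (-u)) := by ring
    _ = 2 ^ n * n.factorial * (exp (1 / 2) * exp (-u / 2)) := by
        rw [← exp_add, ← exp_add]; congr 2; ring
    _ = _ := by ring

namespace inY

variable {f : ℝ → ℝ}

theorem expDecay (hf : inY f) (j : ℕ) : ExpDecay (iteratedDeriv j f) := by
  obtain ⟨K, r, hK, -, h⟩ := hf.2 j
  obtain ⟨C, hC⟩ := one_add_rpow_mul_exp_neg_le (r := r)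
  refine ⟨K * C, fun x => (h x).trans ?_⟩
  rw [mul_assoc, mul_assoc]
  exact mul_le_mul_of_nonneg_left (hC |x| (abs_nonneg x)) hK.le

theorem hasDerivAt (hf : inY f) (j : ℕ) (x : ℝ) :
    HasDerivAt (iteratedDeriv j f) (iteratedDeriv (j + 1) f x) x := by
  rw [iteratedDeriv_succ]
  exact ((hf.1.differentiable_iteratedDeriv j (by exact_mod_cast WithTop.coe_lt_top j)) x).hasDerivAt

theorem continuous (hf : inY f) : Continuous f := hf.1.continuous

end inY

theorem iteratedDeriv_two_of_hasDerivAt {f f₁ f₂ : ℝ → ℝ} (h₁ : ∀ x, HasDerivAt f (f₁ x) x)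
    (h₂ : ∀ x, HasDerivAt f₁ (f₂ x) x) : iteratedDeriv 2 f = f₂ := by
  rw [iteratedDeriv_succ, iteratedDeriv_one, funext fun x => (h₁ x).deriv]
  exact funext fun x => (h₂ x).deriv

theorem Qs_pos (x : ℝ) : 0 < Qs x := by
  unfold Qs
  have := cosh_pos (x / 2)
  positivity

theorem tanh_half_sq (x : ℝ) : tanh (x / 2) ^ 2 = 1 - 2 / 3 * Qs x := by
  have h := (cosh_pos (x / 2)).ne'
  rw [tanh_eq_sinh_div_cosh, Qs]
  field_simp
  linarith [cosh_sq (x / 2)]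

theorem hasDerivAt_tanh_half (x : ℝ) :
    HasDerivAt (fun y : ℝ => tanh (y / 2)) (Qs x / 3) x := by
  have h := (cosh_pos (x / 2)).ne'
  have hd : HasDerivAt (fun y : ℝ => y / 2) (1 / 2) x := (hasDerivAt_id x).div_const 2
  have := hd.sinh.div hd.cosh h
  simp only [tanh_eq_sinh_div_cosh]
  refine this.congr_deriv ?_
  rw [Qs]
  field_simp
  linarith [cosh_sq (x / 2)]

theorem hasDerivAt_Qs (x : ℝ) : HasDerivAt Qs (-(Qs x * tanh (x / 2))) x := by
  have hQ : Qs = fun y => 3 / 2 * (1 - tanh (y / 2) ^ 2) := by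
    funext y; rw [tanh_half_sq]; ring
  have h := (((hasDerivAt_tanh_half x).fun_pow 2).const_sub 1).const_mul (3 / 2 : ℝ)
  rw [← hQ] at h
  exact h.congr_deriv (by push_cast; ring)

theorem hasDerivAt_neg_Qs_mul_tanh (x : ℝ) :
    HasDerivAt (fun y => -(Qs y * tanh (y / 2))) (Qs x - Qs x ^ 2) x := by
  refine ((hasDerivAt_Qs x).mul (hasDerivAt_tanh_half x)).neg.congr_deriv ?_
  linear_combination Qs x * tanh_half_sq x

theorem hasDerivAt_id_mul_Qs (x : ℝ) :
    HasDerivAt (fun y => y * Qs y) (Qs x - x * Qs x * tanh (x / 2)) x := by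
  refine ((hasDerivAt_id x).mul (hasDerivAt_Qs x)).congr_deriv ?_
  simp only [id]; ring

theorem deriv_Qs : deriv Qs = fun x => -(Qs x * tanh (x / 2)) :=
  funext fun x => (hasDerivAt_Qs x).deriv

theorem iteratedDeriv_two_Qs : iteratedDeriv 2 Qs = fun x => Qs x - Qs x ^ 2 :=
  iteratedDeriv_two_of_hasDerivAt hasDerivAt_Qs hasDerivAt_neg_Qs_mul_tanh

theorem continuous_Qs : Continuous Qs :=
  continuous_iff_continuousAt.2 fun x => (hasDerivAt_Qs x).continuousAt

theorem continuous_tanh_half : Continuous fun x : ℝ => tanh (x / 2) :=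
  continuous_iff_continuousAt.2 fun x => (hasDerivAt_tanh_half x).continuousAt

theorem phi0_eq (x : ℝ) : phi0 x = tanh (x / 2) := by
  have := (Qs_pos x).ne'
  rw [phi0, deriv_Qs]
  field_simp

theorem Qs_le_exp (x : ℝ) : Qs x ≤ 6 * exp (-|x|) := by
  have h : exp (|x| / 2) / 2 ≤ cosh (x / 2) := by
    rw [← cosh_abs, abs_div, abs_two, cosh_eq]
    linarith [exp_pos (-(|x| / 2))]
  have h2 : exp |x| / 4 ≤ cosh (x / 2) ^ 2 := by
    calc exp |x| / 4 = (exp (|x| / 2) / 2) ^ 2 := by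
          rw [div_pow, ← exp_nat_mul]; push_cast; congr 2 <;> ring_nf
      _ ≤ _ := by gcongr
  rw [Qs, exp_neg, one_div, inv_pow]
  calc 3 / 2 * (cosh (x / 2) ^ 2)⁻¹ ≤ 3 / 2 * (exp |x| / 4)⁻¹ := by gcongr
    _ = _ := by rw [inv_div]; ring

theorem Qs_le (x : ℝ) : Qs x ≤ 3 / 2 := by
  linarith [tanh_half_sq x, sq_nonneg (tanh (x / 2))]

theorem expDecay_Qs : ExpDecay Qs := by
  refine ⟨6, fun x => ?_⟩
  rw [abs_of_pos (Qs_pos x)]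
  refine (Qs_le_exp x).trans ?_
  gcongr
  linarith [abs_nonneg x]

theorem expDecay_id_mul_Qs : ExpDecay (fun x => x * Qs x) := by
  refine ⟨12, fun x => ?_⟩
  rw [abs_mul, abs_of_pos (Qs_pos x)]
  have h : |x| ≤ 2 * exp (|x| / 2) := by linarith [add_one_le_exp (|x| / 2)]
  calc |x| * Qs x ≤ 2 * exp (|x| / 2) * (6 * exp (-|x|)) :=
        mul_le_mul h (Qs_le_exp x) (Qs_pos x).le (by positivity)
    _ = 12 * (exp (|x| / 2) * exp (-|x|)) := by ring
    _ = 12 * exp (-|x| / 2) := by rw [← exp_add]; congr 2; ring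

theorem tendsto_abs_tanh_half : Tendsto (fun x : ℝ => |tanh (x / 2)|) (cocompact ℝ) (𝓝 1) := by
  have h : Tendsto (fun x => √(1 - 2 / 3 * Qs x)) (cocompact ℝ) (𝓝 (√(1 - 2 / 3 * 0))) :=
    ((expDecay_Qs.tendsto.const_mul _).const_sub 1).sqrt
  simpa [← tanh_half_sq, sqrt_sq_eq_abs] using h

theorem tanh_eq_abs {x : ℝ} (hx : 0 ≤ x) : |tanh x| = tanh x := by
  rw [tanh_eq_sinh_div_cosh]
  exact abs_of_nonneg (div_nonneg (sinh_nonneg_iff.2 hx) (cosh_pos x).le)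

theorem tendsto_tanh_half_atTop : Tendsto (fun x : ℝ => tanh (x / 2)) atTop (𝓝 1) := by
  refine (tendsto_abs_tanh_half.mono_left atTop_le_cocompact).congr' ?_
  filter_upwards [eventually_ge_atTop 0] with x hx
  exact tanh_eq_abs (by linarith)

theorem tendsto_tanh_half_atBot : Tendsto (fun x : ℝ => tanh (x / 2)) atBot (𝓝 (-1)) := by
  refine (tendsto_abs_tanh_half.mono_left atBot_le_cocompact).neg.congr' ?_
  filter_upwards [eventually_le_atBot 0] with x hx
  have := tanh_eq_abs (x := -(x / 2)) (by linarith)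
  rw [tanh_neg, abs_neg] at this
  linarith

theorem integrable_Qs_sq : Integrable (fun x => Qs x ^ 2) := by
  have := (expDecay_Qs.mul_bounded (g := Qs) (M := 3 / 2)
    fun x => by rw [abs_of_pos (Qs_pos x)]; exact Qs_le x).integrable
      (continuous_Qs.mul continuous_Qs)
  simpa only [sq] using this

theorem integral_Qs_sq_pos : 0 < ∫ x : ℝ, (Qs x) ^ 2 := by
  rw [integral_pos_iff_support_of_nonneg (fun x => sq_nonneg _) integrable_Qs_sq]
  have : Function.support (fun x => Qs x ^ 2) = Set.univ :=
    Set.eq_univ_of_forall fun x => pow_ne_zero 2 (Qs_pos x).ne'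
  simp [this]

/-- The primitive of `P_λ` vanishing at the origin. -/
noncomputable def primPl (lam x : ℝ) : ℝ :=
  6 * tanh (x / 2) + (3 - lam) / 2 * (x * Qs x - 3 * tanh (x / 2))

theorem Pl_eq (lam x : ℝ) :
    Pl lam x = 2 * Qs x - (3 - lam) / 2 * (x * Qs x * tanh (x / 2)) := by
  rw [Pl, deriv_Qs]; ring

theorem hasDerivAt_primPl (lam x : ℝ) : HasDerivAt (primPl lam) (Pl lam x) x := by
  have ht := hasDerivAt_tanh_half x
  refine ((ht.const_mul 6).add
    (((hasDerivAt_id_mul_Qs x).sub (ht.const_mul 3)).const_mul ((3 - lam) / 2))).congr_deriv ?_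
  rw [Pl_eq]; ring

theorem hasDerivAt_Pl (lam x : ℝ) :
    HasDerivAt (Pl lam) (-((2 + (3 - lam) / 2) * (Qs x * tanh (x / 2)))
      + (3 - lam) / 2 * (x * Qs x - x * Qs x * Qs x)) x := by
  have hP : Pl lam = fun x => 2 * Qs x - (3 - lam) / 2 * (x * Qs x * tanh (x / 2)) :=
    funext (Pl_eq lam)
  rw [hP]
  refine (((hasDerivAt_Qs x).const_mul 2).sub (((hasDerivAt_id_mul_Qs x).mul
    (hasDerivAt_tanh_half x)).const_mul ((3 - lam) / 2))).congr_deriv ?_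
  linear_combination ((3 - lam) / 2 * x * Qs x) * tanh_half_sq x

theorem continuous_Pl (lam : ℝ) : Continuous (Pl lam) :=
  continuous_iff_continuousAt.2 fun x => (hasDerivAt_Pl lam x).continuousAt

theorem integral_Pl_eq (lam x : ℝ) : ∫ y in (0 : ℝ)..x, Pl lam y = primPl lam x := by
  rw [intervalIntegral.integral_eq_sub_of_hasDerivAt (fun y _ => hasDerivAt_primPl lam y)
    ((continuous_Pl lam).intervalIntegrable _ _)]
  simp [primPl]

theorem primPl_bounded (lam : ℝ) : ∃ M, ∀ x, |primPl lam x| ≤ M := by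
  obtain ⟨C, hC⟩ := expDecay_id_mul_Qs
  refine ⟨6 + |(3 - lam) / 2| * (|C| + 3), fun x => ?_⟩
  have ht : |tanh (x / 2)| ≤ 1 := (abs_tanh_lt_one _).le
  have hy : |x * Qs x| ≤ |C| := by
    refine (hC x).trans ((mul_le_mul_of_nonneg_right (le_abs_self C) (exp_pos _).le).trans ?_)
    exact mul_le_of_le_one_right (abs_nonneg C) (exp_le_one_iff.2 (by linarith [abs_nonneg x]))
  unfold primPl
  refine (abs_add_le _ _).trans (add_le_add ?_ ?_)
  · rw [abs_mul, abs_of_pos (by norm_num : (0 : ℝ) < 6)]; linarith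
  · rw [abs_mul]
    refine mul_le_mul_of_nonneg_left ((abs_sub _ _).trans (add_le_add hy ?_)) (abs_nonneg _)
    rw [abs_mul, abs_of_pos (by norm_num : (0 : ℝ) < 3)]; linarith

theorem integrable_Pl (lam : ℝ) : Integrable (Pl lam) := by
  have h1 := expDecay_Qs.integrable continuous_Qs
  have h2 := (expDecay_id_mul_Qs.mul_bounded
    fun x => (abs_tanh_lt_one (x / 2)).le).integrable
      ((continuous_id.mul continuous_Qs).mul continuous_tanh_half)
  rw [funext (Pl_eq lam)]
  exact (h1.const_mul 2).sub (h2.const_mul _)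

theorem tendsto_primPl (lam : ℝ) {l : Filter ℝ} {τ : ℝ} (hl : l ≤ cocompact ℝ)
    (ht : Tendsto (fun x : ℝ => tanh (x / 2)) l (𝓝 τ)) :
    Tendsto (primPl lam) l (𝓝 (6 * τ + (3 - lam) / 2 * (0 - 3 * τ))) :=
  (ht.const_mul 6).add
    (((expDecay_id_mul_Qs.tendsto.mono_left hl).sub (ht.const_mul 3)).const_mul _)

theorem tendsto_Pl (lam : ℝ) {l : Filter ℝ} {τ : ℝ} (hl : l ≤ cocompact ℝ)
    (ht : Tendsto (fun x : ℝ => tanh (x / 2)) l (𝓝 τ)) : Tendsto (Pl lam) l (𝓝 0) := by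
  rw [funext (Pl_eq lam)]
  simpa using ((expDecay_Qs.tendsto.mono_left hl).const_mul 2).sub
    (((expDecay_id_mul_Qs.tendsto.mono_left hl).mul ht).const_mul ((3 - lam) / 2))

theorem Lop_of_hasDerivAt {f f₁ f₂ : ℝ → ℝ} (h₁ : ∀ x, HasDerivAt f (f₁ x) x)
    (h₂ : ∀ x, HasDerivAt f₁ (f₂ x) x) : Lop f = fun x => -f₂ x + f x - 2 * Qs x * f x := by
  funext x
  rw [Lop, iteratedDeriv_two_of_hasDerivAt h₁ h₂]

theorem hasDerivAt_Lop {f f₁ f₂ f₃ : ℝ → ℝ} (h₁ : ∀ x, HasDerivAt f (f₁ x) x)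
    (h₂ : ∀ x, HasDerivAt f₁ (f₂ x) x) (h₃ : ∀ x, HasDerivAt f₂ (f₃ x) x) (x : ℝ) :
    HasDerivAt (Lop f)
      (-f₃ x + f₁ x + 2 * Qs x * tanh (x / 2) * f x - 2 * Qs x * f₁ x) x := by
  rw [Lop_of_hasDerivAt h₁ h₂]
  refine (((h₃ x).neg.add (h₁ x)).sub
    (((hasDerivAt_Qs x).const_mul 2).mul (h₁ x))).congr_deriv ?_
  ring

theorem tendsto_Lop {f f₁ f₂ : ℝ → ℝ} (h₁ : ∀ x, HasDerivAt f (f₁ x) x)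
    (h₂ : ∀ x, HasDerivAt f₁ (f₂ x) x) {l : Filter ℝ} (hl : l ≤ cocompact ℝ) {c : ℝ}
    (hf : Tendsto f l (𝓝 c)) (hf₂ : Tendsto f₂ l (𝓝 0)) : Tendsto (Lop f) l (𝓝 c) := by
  rw [Lop_of_hasDerivAt h₁ h₂]
  simpa using (hf₂.neg.add hf).sub (((expDecay_Qs.tendsto.mono_left hl).const_mul 2).mul hf)

/-- The forcing profile `(λ - 3) Q'' - Q²`. -/
noncomputable def forcing (lam x : ℝ) : ℝ := (lam - 3) * (Qs x - Qs x ^ 2) - Qs x ^ 2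

theorem hasDerivAt_forcing (lam x : ℝ) :
    HasDerivAt (forcing lam) ((lam - 3) * (-(Qs x * tanh (x / 2)))
      + 2 * (lam - 2) * (Qs x * (Qs x * tanh (x / 2)))) x := by
  have hQ := hasDerivAt_Qs x
  refine (((hQ.sub (hQ.fun_pow 2)).const_mul (lam - 3)).sub (hQ.fun_pow 2)).congr_deriv ?_
  push_cast
  ring

theorem tendsto_forcing (lam : ℝ) {l : Filter ℝ} (hl : l ≤ cocompact ℝ) :
    Tendsto (forcing lam) l (𝓝 0) := by
  have hQ := expDecay_Qs.tendsto.mono_left hl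
  unfold forcing
  simpa using ((hQ.sub (hQ.pow 2)).const_mul (lam - 3)).sub (hQ.pow 2)

/-- A decaying primitive of
`((15 + 10 λ - λ²) / 20) Q² - (3 - λ) Q'' P_λ - Q² P_λ - (2 λ - 3) Q Q''`. -/
noncomputable def profileRemainder (lam x : ℝ) : ℝ :=
  -((3 - lam) ^ 2 / 4 * (x * Qs x * (Qs x * tanh (x / 2) ^ 2))
    + (3 - lam) / 6 * (x * Qs x * Qs x ^ 2)
    + 3 / 5 * ((3 - lam) ^ 2 / 6 - (3 - lam) / 6 - 1) * (Qs x ^ 2 * tanh (x / 2)))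

theorem hasDerivAt_profileRemainder (lam x : ℝ) :
    HasDerivAt (profileRemainder lam)
      ((15 + 10 * lam - lam ^ 2) / 20 * Qs x ^ 2
        - ((3 - lam) * (Qs x - Qs x ^ 2) + Qs x ^ 2) * Pl lam x
        - (2 * lam - 3) * (Qs x * (Qs x - Qs x ^ 2))) x := by
  have hQ := hasDerivAt_Qs x
  have ht := hasDerivAt_tanh_half x
  have hy := hasDerivAt_id_mul_Qs x
  refine ((((hy.fun_mul (hQ.fun_mul (ht.fun_pow 2))).const_mul ((3 - lam) ^ 2 / 4)).fun_add
    ((hy.fun_mul (hQ.fun_pow 2)).const_mul ((3 - lam) / 6))).fun_add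
    (((hQ.fun_pow 2).fun_mul ht).const_mul
      (3 / 5 * ((3 - lam) ^ 2 / 6 - (3 - lam) / 6 - 1)))).fun_neg.congr_deriv ?_
  have h := tanh_half_sq x
  rw [Pl_eq]
  push_cast
  generalize tanh (x / 2) = t at *
  generalize Qs x = q at *
  obtain rfl : q = 3 / 2 * (1 - t ^ 2) := by linarith
  ring

theorem tendsto_profileRemainder (lam : ℝ) {l : Filter ℝ} {τ : ℝ} (hl : l ≤ cocompact ℝ)
    (ht : Tendsto (fun x : ℝ => tanh (x / 2)) l (𝓝 τ)) :
    Tendsto (profileRemainder lam) l (𝓝 0) := by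
  have hQ := expDecay_Qs.tendsto.mono_left hl
  have hy := expDecay_id_mul_Qs.tendsto.mono_left hl
  unfold profileRemainder
  simpa using ((((hy.mul (hQ.mul (ht.pow 2))).const_mul ((3 - lam) ^ 2 / 4)).add
    ((hy.mul (hQ.pow 2)).const_mul ((3 - lam) / 6))).add
    (((hQ.pow 2).mul ht).const_mul
      (3 / 5 * ((3 - lam) ^ 2 / 6 - (3 - lam) / 6 - 1)))).neg

/-- The total boundary term produced by testing the system against `Q` and `∫ P_λ`. -/
noncomputable def boundaryTerm (lam γ a : ℝ) (A A₁ B B₁ : ℝ → ℝ) (x : ℝ) : ℝ :=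
  Lop B x * Qs x - B₁ x * (Qs x * tanh (x / 2)) - B x * (Qs x - Qs x ^ 2)
    - (3 - lam) * (A₁ x * Qs x + A x * (Qs x * tanh (x / 2)))
    + A₁ x * Pl lam x
    - A x * (-((2 + (3 - lam) / 2) * (Qs x * tanh (x / 2)))
      + (3 - lam) / 2 * (x * Qs x - x * Qs x * Qs x))
    + (Lop A x - γ) * primPl lam x - a * (forcing lam x * primPl lam x)
    + a * profileRemainder lam x

theorem tendsto_boundaryTerm (lam γ a : ℝ) {A A₁ A₂ B B₁ B₂ : ℝ → ℝ}
    (hA : ∀ x, HasDerivAt A (A₁ x) x) (hA₁ : ∀ x, HasDerivAt A₁ (A₂ x) x)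
    (hB : ∀ x, HasDerivAt B (B₁ x) x) (hB₁ : ∀ x, HasDerivAt B₁ (B₂ x) x)
    {l : Filter ℝ} (hl : l ≤ cocompact ℝ) {τ β : ℝ}
    (ht : Tendsto (fun x : ℝ => tanh (x / 2)) l (𝓝 τ))
    (lA : Tendsto A l (𝓝 γ)) (lA₁ : Tendsto A₁ l (𝓝 0)) (lA₂ : Tendsto A₂ l (𝓝 0))
    (lB : Tendsto B l (𝓝 β)) (lB₁ : Tendsto B₁ l (𝓝 0)) (lB₂ : Tendsto B₂ l (𝓝 0)) :
    Tendsto (boundaryTerm lam γ a A A₁ B B₁) l (𝓝 0) := by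
  have hQ := expDecay_Qs.tendsto.mono_left hl
  have hy := expDecay_id_mul_Qs.tendsto.mono_left hl
  have hI := tendsto_primPl lam hl ht
  have hLA := tendsto_Lop hA hA₁ hl lA lA₂
  have hLB := tendsto_Lop hB hB₁ hl lB lB₂
  have h := (((((((hLB.mul hQ).sub (lB₁.mul (hQ.mul ht))).sub (lB.mul (hQ.sub (hQ.pow 2)))).sub
    (((lA₁.mul hQ).add (lA.mul (hQ.mul ht))).const_mul (3 - lam))).add
    (lA₁.mul (tendsto_Pl lam hl ht))).sub
    (lA.mul (((hQ.mul ht).const_mul (2 + (3 - lam) / 2)).neg.add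
      ((hy.sub (hy.mul hQ)).const_mul ((3 - lam) / 2))))).add
    ((hLA.sub_const γ).mul hI)).sub (((tendsto_forcing lam hl).mul hI).const_mul a) |>.add
    ((tendsto_profileRemainder lam hl ht).const_mul a)
  unfold boundaryTerm
  simpa using h

theorem hasDerivAt_boundaryTerm (lam γ a : ℝ) {A A₁ A₂ A₃ B B₁ B₂ B₃ F G : ℝ → ℝ}
    (hA : ∀ x, HasDerivAt A (A₁ x) x) (hA₁ : ∀ x, HasDerivAt A₁ (A₂ x) x)
    (hA₂ : ∀ x, HasDerivAt A₂ (A₃ x) x)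
    (hB : ∀ x, HasDerivAt B (B₁ x) x) (hB₁ : ∀ x, HasDerivAt B₁ (B₂ x) x)
    (hB₂ : ∀ x, HasDerivAt B₂ (B₃ x) x)
    (heq1 : ∀ x, deriv (Lop A) x = a * deriv (forcing lam) x + F x)
    (heq2 : ∀ x, deriv (Lop B) x = (3 - lam) * A₂ x + 2 * Qs x * A x
      + a * (2 * lam - 3) * (Qs x - Qs x ^ 2) + G x) (x : ℝ) :
    HasDerivAt (boundaryTerm lam γ a A A₁ B B₁)
      (a * ((15 + 10 * lam - lam ^ 2) / 20) * Qs x ^ 2 - γ * Pl lam x + G x * Qs x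
        + F x * primPl lam x) x := by
  have hQ := hasDerivAt_Qs x
  have ht := hasDerivAt_tanh_half x
  have hy := hasDerivAt_id_mul_Qs x
  have hI := hasDerivAt_primPl lam x
  have hLA := hasDerivAt_Lop hA hA₁ hA₂ x
  have hLB := hasDerivAt_Lop hB hB₁ hB₂ x
  have hN := hasDerivAt_forcing lam x
  have e1 := heq1 x
  have e2 := heq2 x
  rw [hLA.deriv, hN.deriv] at e1
  rw [hLB.deriv] at e2
  have h := (((((((hLB.fun_mul hQ).fun_sub ((hB₁ x).fun_mul (hQ.fun_mul ht))).fun_sub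
    ((hB x).fun_mul (hQ.fun_sub (hQ.fun_pow 2)))).fun_sub
    ((((hA₁ x).fun_mul hQ).fun_add ((hA x).fun_mul (hQ.fun_mul ht))).const_mul (3 - lam))).fun_add
    ((hA₁ x).fun_mul (hasDerivAt_Pl lam x))).fun_sub
    ((hA x).fun_mul (((hQ.fun_mul ht).const_mul (2 + (3 - lam) / 2)).fun_neg.fun_add
      ((hy.fun_sub (hy.fun_mul hQ)).const_mul ((3 - lam) / 2))))).fun_add
    ((hLA.sub_const γ).fun_mul hI)).fun_sub ((hN.fun_mul hI).const_mul a) |>.fun_add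
    ((hasDerivAt_profileRemainder lam x).const_mul a)
  refine h.congr_deriv ?_
  rw [Lop_of_hasDerivAt hA hA₁, Lop_of_hasDerivAt hB hB₁]
  simp only [forcing, Pl_eq]
  push_cast
  have hs := tanh_half_sq x
  generalize primPl lam x = I at *
  generalize tanh (x / 2) = t at *
  generalize Qs x = q at *
  obtain rfl : q = 3 / 2 * (1 - t ^ 2) := by linarith
  linear_combination (3 / 2 * (1 - t ^ 2)) * e2 + I * e1

/-- the value of `a` is determined by the system `(Ω)`. -/
theorem a_determined (lam : ℝ) (hlam : lam ∈ Set.Ioo (0:ℝ) 1)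
    (F G : ℝ → ℝ) (hF : inY F) (hG : inY G)
    (γ b a : ℝ) (Atil Btil : ℝ → ℝ) (hAt : inY Atil) (hBt : inY Btil)
    (A B : ℝ → ℝ)
    (hAdef : A = fun x => Atil x + γ)
    (hBdef : B = fun x => Btil x + b * phi0 x)
    (heq1 : ∀ x : ℝ, deriv (Lop A) x
      = a * deriv (fun y => (lam - 3) * iteratedDeriv 2 Qs y - (Qs y)^2) x + F x)
    (heq2 : ∀ x : ℝ, deriv (Lop B) x
      = (3 - lam) * iteratedDeriv 2 A x + 2 * Qs x * A x
          + a * (2*lam - 3) * iteratedDeriv 2 Qs x + G x) :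
    a = -(20/(15 + 10*lam - lam^2)) * (1 / ∫ x : ℝ, (Qs x)^2) *
        (-γ * (∫ x : ℝ, Pl lam x) + (∫ x : ℝ, G x * Qs x)
          + ∫ x : ℝ, F x * (∫ y in (0:ℝ)..x, Pl lam y)) := by
  have hA0 : ∀ x, HasDerivAt A (iteratedDeriv 1 Atil x) x := fun x => by
    rw [hAdef]
    simpa using (hAt.hasDerivAt 0 x).add_const γ
  have hB0 : ∀ x, HasDerivAt B (iteratedDeriv 1 Btil x + b * (Qs x / 3)) x := fun x => by
    rw [hBdef, funext phi0_eq]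
    simpa using (hBt.hasDerivAt 0 x).fun_add ((hasDerivAt_tanh_half x).const_mul b)
  have hB1 : ∀ x, HasDerivAt (fun x => iteratedDeriv 1 Btil x + b * (Qs x / 3))
      (iteratedDeriv 2 Btil x + b * (-(Qs x * tanh (x / 2)) / 3)) x := fun x =>
    (hBt.hasDerivAt 1 x).add (((hasDerivAt_Qs x).div_const 3).const_mul b)
  have hB2 : ∀ x, HasDerivAt (fun x => iteratedDeriv 2 Btil x + b * (-(Qs x * tanh (x / 2)) / 3))
      (iteratedDeriv 3 Btil x + b * ((Qs x - Qs x ^ 2) / 3)) x := fun x =>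
    (hBt.hasDerivAt 2 x).add (((hasDerivAt_neg_Qs_mul_tanh x).div_const 3).const_mul b)
  rw [iteratedDeriv_two_Qs] at heq1 heq2
  rw [iteratedDeriv_two_of_hasDerivAt hA0 (hAt.hasDerivAt 1)] at heq2
  have hderiv := hasDerivAt_boundaryTerm lam γ a hA0 (hAt.hasDerivAt 1) (hAt.hasDerivAt 2)
    hB0 hB1 hB2 heq1 heq2
  have hlim : ∀ {l : Filter ℝ} {τ : ℝ}, l ≤ cocompact ℝ →
      Tendsto (fun x : ℝ => tanh (x / 2)) l (𝓝 τ) →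
      Tendsto (boundaryTerm lam γ a A (iteratedDeriv 1 Atil) B
        (fun x => iteratedDeriv 1 Btil x + b * (Qs x / 3))) l (𝓝 0) := by
    intro l τ hl ht
    have hQ := expDecay_Qs.tendsto.mono_left hl
    refine tendsto_boundaryTerm lam γ a (β := b * τ) hA0 (hAt.hasDerivAt 1) hB0 hB1 hl ht
      ?_ ((hAt.expDecay 1).tendsto.mono_left hl) ((hAt.expDecay 2).tendsto.mono_left hl) ?_ ?_ ?_
    · rw [hAdef]
      simpa using ((hAt.expDecay 0).tendsto.mono_left hl).add_const γ
    · rw [hBdef, funext phi0_eq]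
      simpa using ((hBt.expDecay 0).tendsto.mono_left hl).add (ht.const_mul b)
    · simpa using ((hBt.expDecay 1).tendsto.mono_left hl).add ((hQ.div_const 3).const_mul b)
    · simpa using ((hBt.expDecay 2).tendsto.mono_left hl).add
        (((hQ.mul ht).neg.div_const 3).const_mul b)
  have hQb : ∀ x, |Qs x| ≤ 3 / 2 := fun x => by rw [abs_of_pos (Qs_pos x)]; exact Qs_le x
  obtain ⟨M, hM⟩ := primPl_bounded lam
  have iQ := integrable_Qs_sq.const_mul (a * ((15 + 10 * lam - lam ^ 2) / 20))
  have iP := (integrable_Pl lam).const_mul γ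
  have iG : Integrable (fun x => G x * Qs x) :=
    ((by simpa using hG.expDecay 0 : ExpDecay G).mul_bounded hQb).integrable
      (hG.continuous.mul continuous_Qs)
  have iF : Integrable (fun x => F x * primPl lam x) :=
    ((by simpa using hF.expDecay 0 : ExpDecay F).mul_bounded hM).integrable
      (hF.continuous.mul (continuous_iff_continuousAt.2
        fun x => (hasDerivAt_primPl lam x).continuousAt))
  have iQP := iQ.sub' iP
  have iQPG := iQP.fun_add iG
  have key := integral_of_hasDerivAt_of_tendsto hderiv (iQPG.fun_add iF)
    (hlim atBot_le_cocompact tendsto_tanh_half_atBot)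
    (hlim atTop_le_cocompact tendsto_tanh_half_atTop)
  rw [integral_add iQPG iF, integral_add iQP iG, integral_sub iQ iP,
    integral_const_mul, integral_const_mul] at key
  simp only [integral_Pl_eq]
  have hq := integral_Qs_sq_pos.ne'
  have hκ : 15 + 10 * lam - lam ^ 2 ≠ 0 := by
    have h0 := hlam.1
    have h1 := hlam.2
    nlinarith
  field_simp
  linear_combination 20 * key
end

section
/- The polynomial g(λ) = 3375 + 3375λ − 75(44 − 3π²)λ² − 300(16 − π²)λ³ − 5(207 − 14π²)λ⁴ + 5(45 − 4π²)λ⁵ + π²λ⁶ satisfies g(λ) > 0 for all λ ∈ [0,1]. -/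
open Real MeasureTheory Filter

/-- the polynomial `g` is positive on `[0,1]`. -/
theorem g_positive (lam : ℝ) (hlam : lam ∈ Set.Icc (0:ℝ) 1) :
    0 < 3375 + 3375*lam - 75*(44 - 3*Real.pi^2)*lam^2 - 300*(16 - Real.pi^2)*lam^3
        - 5*(207 - 14*Real.pi^2)*lam^4 + 5*(45 - 4*Real.pi^2)*lam^5 + Real.pi^2*lam^6 := by
  obtain ⟨h0, h1⟩ := hlam
  have hpi : 9 ≤ Real.pi ^ 2 := by nlinarith [Real.pi_gt_three]
  have hcoeff : 0 ≤ 225 * lam ^ 2 + 300 * lam ^ 3 + 70 * lam ^ 4 - 20 * lam ^ 5 + lam ^ 6 := by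
    have h5 : lam ^ 5 ≤ lam ^ 4 := pow_le_pow_of_le_one h0 h1 (by norm_num)
    have : 0 ≤ lam ^ 2 := by positivity
    have : 0 ≤ lam ^ 3 := by positivity
    have : 0 ≤ lam ^ 4 := by positivity
    have : 0 ≤ lam ^ 6 := by positivity
    linarith
  have hnine : 0 < 3375 + 3375 * lam - 1275 * lam ^ 2 - 2100 * lam ^ 3 - 405 * lam ^ 4
      + 45 * lam ^ 5 + 9 * lam ^ 6 := by
    have h2 : lam ^ 2 ≤ lam := pow_le_of_le_one h0 h1 (by norm_num)
    have h3 : lam ^ 3 ≤ lam := pow_le_of_le_one h0 h1 (by norm_num)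
    have h4 : lam ^ 4 ≤ lam := pow_le_of_le_one h0 h1 (by norm_num)
    have : 0 ≤ lam ^ 5 := by positivity
    have : 0 ≤ lam ^ 6 := by positivity
    linarith
  linarith [mul_nonneg (sub_nonneg.mpr hpi) hcoeff]
end
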